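/- Let A and B be commutative ℂ-algebras that are integral domains, let v be a valuation on A and w a valuation on B (both lifting the trivial valuation on ℂ), and let S, T ≥ 0 be real numbers. Define u : A ⊗_ℂ B → ℝ ∪ {-∞} by u(0) = -∞ and, for x ≠ 0, u(x) = the infimum over all representations x = Σᵢ aᵢ ⊗ bᵢ (finite sums, aᵢ ∈ A, bᵢ ∈ B nonzero) of maxᵢ (S·v(aᵢ) + T·w(bᵢ)). Then u is a valuation on A ⊗_ℂ B: u(xy) = u(x) + u(y) for all x, y, u(x + y) ≤ max(u(x), u(y)), and u(c) = 0 for all c ∈ ℂ*. (This is the quasivaluation S∘v ⊕ T∘w of the sum filtration; the content is that it is multiplicative, i.e. its associated graded algebra is a domain.) -/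

import Mathlib

open scoped TensorProduct

/-- Multiplication of an element of ℝ ∪ {-∞} by a real scalar (sending -∞ to -∞). -/
noncomputable def scaleW (r : ℝ) (x : WithBot ℝ) : WithBot ℝ := x.map (fun a => r * a)

section SpecialPoint

variable {k : Type*} [Field k] [IsAlgClosed k]

/-- The weak Nullstellensatz: a nonzero algebra of finite type over an algebraically closed field
has a rational point. -/
theorem nonempty_algHom_of_finiteType (C : Type*) [CommRing C] [Nontrivial C] [Algebra k C]
    [Algebra.FiniteType k C] : Nonempty (C →ₐ[k] k) := by
  obtain ⟨m, hm⟩ := Ideal.exists_maximal C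
  let : Field (C ⧸ m) := Ideal.Quotient.field m
  have : Module.Finite k (C ⧸ m) := finite_of_finite_type_of_isJacobsonRing k (C ⧸ m)
  let e : k ≃ₐ[k] (C ⧸ m) := AlgEquiv.ofBijective (Algebra.ofId k (C ⧸ m))
    (IsAlgClosed.algebraMap_bijective_of_isIntegral (k := k) (K := C ⧸ m))
  exact ⟨e.symm.toAlgHom.comp (Ideal.Quotient.mkₐ k m)⟩

/-- Given a proper ideal of a subalgebra `O` of `L` and a finite set `s`, there is a linear form on
`L` which kills the ideal and is multiplicative on the elements of `s` lying in `O`. -/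
theorem exists_linearMap_mul_of_finite {L : Type*} [CommRing L] [Algebra k L]
    (O : Subalgebra k L) (I : Ideal O) (hI : I ≠ ⊤) {s : Set L} (hs : s.Finite) :
    ∃ l : L →ₗ[k] k, (∀ z ∈ I, l z = 0) ∧ l 1 = 1 ∧
      ∀ a ∈ s, ∀ b ∈ s, a ∈ O → b ∈ O → l (a * b) = l a * l b := by
  have : Nontrivial (O ⧸ I) := Ideal.Quotient.nontrivial_iff.mpr hI
  let t : Set (O ⧸ I) := Ideal.Quotient.mkₐ k I '' (Subtype.val ⁻¹' s)
  have ht : t.Finite := (hs.preimage Subtype.val_injective.injOn).image _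
  let C := Algebra.adjoin k t
  have : Algebra.FiniteType k C :=
    (Subalgebra.fg_iff_finiteType C).mp (Subalgebra.fg_def.mpr ⟨t, ht, rfl⟩)
  obtain ⟨ρ⟩ := nonempty_algHom_of_finiteType (k := k) C
  obtain ⟨r, hr⟩ := LinearMap.exists_extend (p := Subalgebra.toSubmodule C) ρ.toLinearMap
  obtain ⟨l, hl⟩ := LinearMap.exists_extend (p := Subalgebra.toSubmodule O)
    (r ∘ₗ (Ideal.Quotient.mkₐ k I).toLinearMap)
  have hr' (z : C) : r z = ρ z := LinearMap.congr_fun hr z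
  have hl' (z : O) : l z = r (Ideal.Quotient.mkₐ k I z) := LinearMap.congr_fun hl z
  have hmem (a : O) (ha : (a : L) ∈ s) : Ideal.Quotient.mkₐ k I a ∈ C :=
    Algebra.subset_adjoin ⟨a, ha, rfl⟩
  refine ⟨l, fun z hz => ?_, ?_, fun a ha b hb haO hbO => ?_⟩
  · rw [hl', Ideal.Quotient.mkₐ_eq_mk, Ideal.Quotient.eq_zero_iff_mem.mpr hz, map_zero]
  · have h := hl' 1
    rw [map_one] at h
    simpa using h.trans ((hr' 1).trans (map_one ρ))
  · have h1 := hl' (⟨a, haO⟩ * ⟨b, hbO⟩)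
    rw [map_mul] at h1
    have h2 := hr' (⟨_, hmem ⟨a, haO⟩ ha⟩ * ⟨_, hmem ⟨b, hbO⟩ hb⟩)
    rw [map_mul, ← hr', ← hr', ← hl', ← hl'] at h2
    exact h1.trans h2

end SpecialPoint

/-- A valuation on a `k`-algebra with values in `ℝ ∪ {-∞}` lifting the trivial valuation on `k`.
Nonzero elements are allowed to have value `-∞`. -/
structure LiftsTrivial (k : Type*) {A : Type*} [Field k] [CommRing A] [Algebra k A]
    (v : A → WithBot ℝ) : Prop where
  map_mul : ∀ a b : A, v (a * b) = v a + v b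
  map_add_le : ∀ a b : A, v (a + b) ≤ max (v a) (v b)
  map_algebraMap : ∀ c : k, c ≠ 0 → v (algebraMap k A c) = 0
  map_zero : v 0 = ⊥

namespace LiftsTrivial

section Basic

variable {k A : Type*} [Field k] [CommRing A] [Algebra k A] {v : A → WithBot ℝ}

theorem map_one (hv : LiftsTrivial k v) : v 1 = 0 := by
  simpa using hv.map_algebraMap 1 one_ne_zero

theorem map_smul (hv : LiftsTrivial k v) {c : k} (hc : c ≠ 0) (a : A) : v (c • a) = v a := by
  rw [Algebra.smul_def, hv.map_mul, hv.map_algebraMap c hc, zero_add]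

theorem map_smul_le (hv : LiftsTrivial k v) (c : k) (a : A) : v (c • a) ≤ v a := by
  rcases eq_or_ne c 0 with rfl | hc
  · simp [hv.map_zero]
  · exact (hv.map_smul hc a).le

theorem map_neg (hv : LiftsTrivial k v) (a : A) : v (-a) = v a := by
  simpa using hv.map_smul (c := (-1 : k)) (by simp) a

theorem map_sub_le (hv : LiftsTrivial k v) (a b : A) : v (a - b) ≤ max (v a) (v b) := by
  simpa [sub_eq_add_neg, hv.map_neg] using hv.map_add_le a (-b)

/-- The subspace of elements of value at most `t`. -/
def leSubmodule (hv : LiftsTrivial k v) (t : WithBot ℝ) : Submodule k A where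
  carrier := {a | v a ≤ t}
  add_mem' ha hb := (hv.map_add_le _ _).trans (max_le ha hb)
  zero_mem' := by simp [hv.map_zero]
  smul_mem' c a ha := (hv.map_smul_le c a).trans ha

/-- The subspace of elements of value less than the real number `t`. -/
def ltSubmodule (hv : LiftsTrivial k v) (t : ℝ) : Submodule k A where
  carrier := {a | v a < t}
  add_mem' ha hb := (hv.map_add_le _ _).trans_lt (max_lt ha hb)
  zero_mem' := by simp [hv.map_zero]
  smul_mem' c a ha := (hv.map_smul_le c a).trans_lt ha

theorem mem_ltSubmodule (hv : LiftsTrivial k v) {t : ℝ} {a : A} :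
    a ∈ hv.ltSubmodule t ↔ v a < t := Iff.rfl

variable (k) in
/-- A finite family is orthogonal if the value of each linear combination is at least
the value of every vector occurring in it. -/
def IsOrthogonal {ι : Type*} [Fintype ι] (v : A → WithBot ℝ) (f : ι → A) : Prop :=
  ∀ c : ι → k, ∀ j, c j ≠ 0 → v (f j) ≤ v (∑ i, c i • f i)

/-- Every coset of a finite-dimensional subspace has an element of least value. -/
theorem exists_min_add (hv : LiftsTrivial k v) (W : Submodule k A) [FiniteDimensional k W] (b : A) :
    ∃ g ∈ W, ∀ h ∈ W, v (b + g) ≤ v (b + h) := by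
  let W' : Submodule k A := W ⊔ k ∙ b
  let F : W → Submodule k W' := fun g => (hv.leSubmodule (v (b + g))).comap W'.subtype
  obtain ⟨g, -, hg⟩ := (InvImage.wf F (wellFounded_lt (α := Submodule k W'))).has_min
    Set.univ ⟨0, trivial⟩
  refine ⟨g, g.2, fun h hh => ?_⟩
  by_contra! hlt
  refine hg ⟨h, hh⟩ trivial (lt_of_le_of_ne (fun z hz => le_trans hz hlt.le) fun heq => ?_)
  have hb : b + g ∈ W' := add_mem (Submodule.mem_sup_right (Submodule.mem_span_singleton_self b))
    (Submodule.mem_sup_left g.2)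
  have : (⟨b + g, hb⟩ : W') ∈ F g := le_refl (v (b + g))
  rw [← heq] at this
  exact absurd this (not_le.mpr hlt)

theorem exists_orthogonal (hv : LiftsTrivial k v) {n : ℕ} (b : Fin n → A) :
    ∃ f : Fin n → A, IsOrthogonal k v f ∧ ∀ i, b i ∈ Submodule.span k (Set.range f) := by
  induction n with
  | zero => exact ⟨b, fun _ j => j.elim0, fun j => j.elim0⟩
  | succ n ih =>
    obtain ⟨f, hf, hbf⟩ := ih (Fin.tail b)
    set W := Submodule.span k (Set.range f)
    have : FiniteDimensional k W := FiniteDimensional.span_of_finite k (Set.finite_range f)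
    obtain ⟨g, hg, hmin⟩ := hv.exists_min_add W (b 0)
    have hW : W ≤ Submodule.span k (Set.range (Fin.cons (b 0 + g) f : Fin (n + 1) → A)) := by
      rw [Fin.range_cons]
      exact Submodule.span_mono (Set.subset_insert _ _)
    refine ⟨Fin.cons (b 0 + g) f, fun c j hj => ?_, fun i => ?_⟩
    · simp only [Fin.sum_univ_succ, Fin.cons_zero, Fin.cons_succ]
      set z := ∑ i : Fin n, c i.succ • f i with hz
      have hzW : z ∈ W := Submodule.sum_mem _ fun i _ =>
        Submodule.smul_mem _ _ (Submodule.subset_span ⟨i, rfl⟩)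
      rcases eq_or_ne (c 0) 0 with h0 | h0
      · rw [h0, zero_smul, zero_add]
        cases j using Fin.cases with
        | zero => exact absurd h0 hj
        | succ j => exact hf (fun i => c i.succ) j hj
      · have hle : v (b 0 + g) ≤ v (c 0 • (b 0 + g) + z) := by
          have h1 : c 0 • (b 0 + g) + z = c 0 • (b 0 + (g + (c 0)⁻¹ • z)) := by
            rw [← add_assoc, smul_add (c 0) (b 0 + g), smul_inv_smul₀ h0]
          rw [h1, hv.map_smul h0]
          exact hmin _ (add_mem hg (Submodule.smul_mem _ _ hzW))
        cases j using Fin.cases with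
        | zero => exact hle
        | succ j =>
          have h2 : v z ≤ max (v (c 0 • (b 0 + g) + z)) (v (c 0 • (b 0 + g))) := by
            simpa using hv.map_sub_le (c 0 • (b 0 + g) + z) (c 0 • (b 0 + g))
          rw [hv.map_smul h0, max_eq_left hle] at h2
          exact (hf (fun i => c i.succ) j hj).trans h2
    · cases i using Fin.cases with
      | zero =>
        have hmem : b 0 + g ∈ Set.range (Fin.cons (b 0 + g) f : Fin (n + 1) → A) := ⟨0, rfl⟩
        simpa only [add_sub_cancel_right] using
          sub_mem (Submodule.subset_span hmem) (hW hg)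
      | succ i => exact hW (hbf i)

theorem exists_orthogonal_tmul {M : Type*} [AddCommGroup M] [Module k M] (hv : LiftsTrivial k v)
    (x : M ⊗[k] A) :
    ∃ (n : ℕ) (m : Fin n → M) (f : Fin n → A), IsOrthogonal k v f ∧ x = ∑ i, m i ⊗ₜ[k] f i := by
  obtain ⟨n, m, b, rfl⟩ := TensorProduct.exists_sum_tmul_eq x
  obtain ⟨f, hf, hb⟩ := hv.exists_orthogonal b
  choose c hc using fun i => (Submodule.mem_span_range_iff_exists_fun k).mp (hb i)
  refine ⟨n, fun j => ∑ i, c i j • m i, f, hf, ?_⟩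
  simp_rw [← hc, TensorProduct.tmul_sum, TensorProduct.sum_tmul]
  rw [Finset.sum_comm]
  simp_rw [TensorProduct.smul_tmul]

end Basic

section InitialForm

variable {k A : Type*} [Field k] [CommRing A] [Algebra k A] {v : A → WithBot ℝ}

theorem add_lt_add_of_lt_of_le_of_ne_bot {a b c d : WithBot ℝ} (h : a < c) (h' : b ≤ d)
    (hd : d ≠ ⊥) : a + b < c + d :=
  (add_le_add_right h' a).trans_lt (WithBot.add_lt_add_right hd h)

/-- The elements of finite value. -/
def finiteSubmonoid (hv : LiftsTrivial k v) : Submonoid A where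
  carrier := {a | v a ≠ ⊥}
  one_mem' := by simp [hv.map_one]
  mul_mem' {a b} ha hb := by simpa [hv.map_mul] using And.intro ha hb

/-- The elements of nonpositive value in the localization at the elements of finite value. -/
def integerSubalgebra (hv : LiftsTrivial k v) :
    Subalgebra k (Localization hv.finiteSubmonoid) where
  carrier := {z | ∃ (a : A) (s : hv.finiteSubmonoid), z = IsLocalization.mk' _ a s ∧ v a ≤ v s}
  mul_mem' := by
    rintro _ _ ⟨a, s, rfl, h⟩ ⟨b, t, rfl, h'⟩
    refine ⟨a * b, s * t, (IsLocalization.mk'_mul _ _ _ _ _).symm, ?_⟩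
    rw [Submonoid.coe_mul, hv.map_mul, hv.map_mul]
    exact add_le_add h h'
  add_mem' := by
    rintro _ _ ⟨a, s, rfl, h⟩ ⟨b, t, rfl, h'⟩
    refine ⟨a * t + b * s, s * t, (IsLocalization.mk'_add _ _ _ _).symm, ?_⟩
    refine (hv.map_add_le _ _).trans ?_
    rw [Submonoid.coe_mul, hv.map_mul, hv.map_mul, hv.map_mul, add_comm (v s)]
    exact max_le (by rw [add_comm]; gcongr) (by gcongr)
  algebraMap_mem' c := by
    refine ⟨algebraMap k A c, 1, ?_, ?_⟩
    · rw [IsLocalization.mk'_one, ← IsScalarTower.algebraMap_apply]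
    · simpa [Algebra.smul_def] using hv.map_smul_le c (1 : A)

/-- The elements of negative value form an ideal in the elements of nonpositive value. -/
def negIdeal (hv : LiftsTrivial k v) : Ideal hv.integerSubalgebra where
  carrier := {z | ∃ (a : A) (s : hv.finiteSubmonoid),
    (z : Localization hv.finiteSubmonoid) = IsLocalization.mk' _ a s ∧ v a < v s}
  zero_mem' := ⟨0, 1, by simp, by simp [hv.map_zero, hv.map_one]⟩
  add_mem' := by
    rintro x y ⟨a, s, hx, h⟩ ⟨b, t, hy, h'⟩
    refine ⟨a * t + b * s, s * t, ?_, ?_⟩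
    · rw [IsLocalization.mk'_add, Subalgebra.coe_add, hx, hy]
    refine (hv.map_add_le _ _).trans_lt ?_
    rw [Submonoid.coe_mul, hv.map_mul, hv.map_mul, hv.map_mul]
    refine max_lt (WithBot.add_lt_add_right t.2 h) ?_
    rw [add_comm (v s)]
    exact WithBot.add_lt_add_right s.2 h'
  smul_mem' := by
    rintro ⟨_, ⟨b, t, rfl, h'⟩⟩ x ⟨a, s, hx, h⟩
    refine ⟨a * b, s * t, ?_, ?_⟩
    · rw [IsLocalization.mk'_mul, smul_eq_mul, Subalgebra.coe_mul, hx, mul_comm]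
    · rw [Submonoid.coe_mul, hv.map_mul, hv.map_mul]
      exact add_lt_add_of_lt_of_le_of_ne_bot h h' t.2

theorem negIdeal_ne_top (hv : LiftsTrivial k v) : hv.negIdeal ≠ ⊤ := by
  rw [Ideal.ne_top_iff_one]
  rintro ⟨a, s, h, hlt⟩
  rw [Subalgebra.coe_one, eq_comm, IsLocalization.mk'_eq_iff_eq_mul, one_mul,
    IsLocalization.eq_iff_exists hv.finiteSubmonoid] at h
  obtain ⟨c, hc⟩ := h
  have := congrArg v hc
  rw [hv.map_mul, hv.map_mul, WithBot.add_left_inj c.2] at this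
  exact hlt.ne this

/-- Linear forms which only see initial forms and behave multiplicatively on finitely many of them:
this is a rational point of the associated graded algebra at which the initial forms of `d` and `d'`
do not vanish. -/
theorem exists_initialForm [IsAlgClosed k] (hv : LiftsTrivial k v) {s : Set A} (hs : s.Finite)
    {d d' : A} (hd : v d ≠ ⊥) (hd' : v d' ≠ ⊥) :
    ∃ (l : A →ₗ[k] k) (p q : A → k), (∀ a, v a < v d + v d' → l a = 0) ∧ p d = 1 ∧ q d' = 1 ∧
      ∀ a ∈ s, ∀ b ∈ s, v a ≤ v d → v b ≤ v d' → l (a * b) = p a * q b := by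
  let e : hv.finiteSubmonoid := ⟨d, hd⟩
  let e' : hv.finiteSubmonoid := ⟨d', hd'⟩
  let L := Localization hv.finiteSubmonoid
  let p (a : A) : L := IsLocalization.mk' L a e
  let q (a : A) : L := IsLocalization.mk' L a e'
  obtain ⟨l, hl, hl1, hlm⟩ := exists_linearMap_mul_of_finite hv.integerSubalgebra hv.negIdeal
    hv.negIdeal_ne_top ((hs.image p).union (hs.image q))
  let φ : A →ₗ[k] L := LinearMap.mulRight k (IsLocalization.mk' L (1 : A) (e * e')) ∘ₗ
    (IsScalarTower.toAlgHom k A L).toLinearMap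
  have hφ (a : A) : φ a = IsLocalization.mk' L a (e * e') := by
    simp only [φ, LinearMap.comp_apply, LinearMap.mulRight_apply, AlgHom.toLinearMap_apply,
      IsScalarTower.coe_toAlgHom']
    rw [IsLocalization.mul_mk'_eq_mk'_of_mul, mul_one]
  refine ⟨l ∘ₗ φ, fun a => l (p a), fun a => l (q a), fun a ha => ?_, ?_, ?_,
    fun a ha b hb hav hbv => ?_⟩
  · rw [← hv.map_mul] at ha
    rw [LinearMap.comp_apply, hφ]
    exact hl ⟨_, a, e * e', rfl, ha.le⟩ ⟨a, e * e', rfl, ha⟩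
  · exact (congrArg l (IsLocalization.mk'_self' L (x := e))).trans hl1
  · exact (congrArg l (IsLocalization.mk'_self' L (x := e'))).trans hl1
  · rw [LinearMap.comp_apply, hφ, IsLocalization.mk'_mul]
    exact hlm _ (.inl ⟨a, ha, rfl⟩) _ (.inr ⟨b, hb, rfl⟩) ⟨a, e, rfl, hav⟩ ⟨b, e', rfl, hbv⟩

end InitialForm

end LiftsTrivial

section Scale

@[simp] theorem scaleW_bot (r : ℝ) : scaleW r ⊥ = ⊥ := rfl

@[simp] theorem scaleW_coe (r a : ℝ) : scaleW r (a : WithBot ℝ) = ((r * a : ℝ) : WithBot ℝ) := rfl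

theorem scaleW_add (r : ℝ) (a b : WithBot ℝ) : scaleW r (a + b) = scaleW r a + scaleW r b := by
  induction a with
  | bot => rfl
  | coe a =>
    induction b with
    | bot => rfl
    | coe b => exact congrArg _ (mul_add r a b)

theorem scaleW_mono {r : ℝ} (hr : 0 ≤ r) : Monotone (scaleW r) :=
  Monotone.withBot_map fun _ _ h => mul_le_mul_of_nonneg_left h hr

/-- The weight `S α + T β` refined lexicographically by `α` and `β`. -/
def lexWeight (S T α β : ℝ) : ℝ ×ₗ ℝ ×ₗ ℝ := toLex (S * α + T * β, toLex (α, β))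

theorem lexWeight_le_iff {S T α β α' β' : ℝ} : lexWeight S T α β ≤ lexWeight S T α' β' ↔
    S * α + T * β < S * α' + T * β' ∨ S * α + T * β = S * α' + T * β' ∧
      (α < α' ∨ α = α' ∧ β ≤ β') := by
  simp [lexWeight, Prod.Lex.toLex_le_toLex]

theorem lt_or_eq_of_lexWeight_le {S T : ℝ} (hS : 0 ≤ S) (hT : 0 ≤ T) {α β γ δ α' β' γ' δ' : ℝ}
    (h : lexWeight S T α β ≤ lexWeight S T α' β') (h' : lexWeight S T γ δ ≤ lexWeight S T γ' δ')
    (hle : α' + γ' ≤ α + γ) :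
    β + δ < β' + δ' ∨ (α = α' ∧ β = β') ∧ γ = γ' ∧ δ = δ' := by
  rw [lexWeight_le_iff] at h h'
  have key (hlt : S * (α + γ) + T * (β + δ) < S * (α' + γ') + T * (β' + δ')) :
      β + δ < β' + δ' := by
    refine lt_of_mul_lt_mul_left ?_ hT
    linarith [mul_le_mul_of_nonneg_left hle hS]
  rcases h with h | ⟨h, ha⟩
  · rcases h' with h' | ⟨h', -⟩ <;> exact .inl (key (by linarith))
  rcases h' with h' | ⟨h', hc⟩
  · exact .inl (key (by linarith))
  rcases ha with ha | ⟨rfl, hb⟩ <;> rcases hc with hc | ⟨rfl, hd⟩ <;> try linarith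
  rcases hb.lt_or_eq with hb | rfl
  · exact .inl (by linarith)
  rcases hd.lt_or_eq with hd | rfl
  · exact .inl (by linarith)
  · simp

end Scale

section Tensor

variable {k A B : Type*} [Field k] [CommRing A] [CommRing B] [Algebra k A] [Algebra k B]
  {v : A → WithBot ℝ} {w : B → WithBot ℝ} {S T : ℝ} {t : WithBot ℝ}

variable (k) in
/-- The sum filtration on `A ⊗ B` attached to `S ∘ v` and `T ∘ w`. -/
def sumFiltration (S T : ℝ) (v : A → WithBot ℝ) (w : B → WithBot ℝ) (t : WithBot ℝ) :
    Submodule k (A ⊗[k] B) :=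
  Submodule.span k {x | ∃ a b, x = a ⊗ₜ[k] b ∧ scaleW S (v a) + scaleW T (w b) ≤ t}

theorem tmul_mem_sumFiltration {a : A} {b : B} (h : scaleW S (v a) + scaleW T (w b) ≤ t) :
    a ⊗ₜ[k] b ∈ sumFiltration k S T v w t :=
  Submodule.subset_span ⟨a, b, rfl, h⟩

theorem mul_mem_sumFiltration (hv : LiftsTrivial k v) (hw : LiftsTrivial k w) {s : WithBot ℝ}
    {x y : A ⊗[k] B} (hx : x ∈ sumFiltration k S T v w s) (hy : y ∈ sumFiltration k S T v w t) :
    x * y ∈ sumFiltration k S T v w (s + t) := by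
  have := Submodule.mul_mem_mul hx hy
  rw [sumFiltration, sumFiltration, Submodule.span_mul_span] at this
  refine Submodule.span_mono ?_ this
  rintro _ ⟨_, ⟨a, b, rfl, h⟩, _, ⟨a', b', rfl, h'⟩, rfl⟩
  refine ⟨a * a', b * b', Algebra.TensorProduct.tmul_mul_tmul _ _ _ _, ?_⟩
  rw [hv.map_mul, hw.map_mul, scaleW_add, scaleW_add, add_add_add_comm]
  exact add_le_add h h'

theorem exists_sum_tmul_of_mem_sumFiltration (hv : LiftsTrivial k v) {x : A ⊗[k] B}
    (hx : x ∈ sumFiltration k S T v w t) :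
    ∃ (n : ℕ) (a : Fin n → A) (b : Fin n → B), (∀ i, a i ≠ 0 ∧ b i ≠ 0) ∧
      x = ∑ i, a i ⊗ₜ[k] b i ∧ ∀ i, scaleW S (v (a i)) + scaleW T (w (b i)) ≤ t := by
  have zero : ∃ (n : ℕ) (a : Fin n → A) (b : Fin n → B), (∀ i, a i ≠ 0 ∧ b i ≠ 0) ∧
      (0 : A ⊗[k] B) = ∑ i, a i ⊗ₜ[k] b i ∧
        ∀ i, scaleW S (v (a i)) + scaleW T (w (b i)) ≤ t :=
    ⟨0, Fin.elim0, Fin.elim0, fun i => i.elim0, by simp, fun i => i.elim0⟩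
  induction hx using Submodule.span_induction with
  | mem x hx =>
    obtain ⟨a, b, rfl, h⟩ := hx
    rcases eq_or_ne a 0 with rfl | ha
    · simpa only [TensorProduct.zero_tmul] using zero
    rcases eq_or_ne b 0 with rfl | hb
    · simpa only [TensorProduct.tmul_zero] using zero
    · exact ⟨1, fun _ => a, fun _ => b, fun _ => ⟨ha, hb⟩, by simp, fun _ => h⟩
  | zero => exact zero
  | add x y _ _ hx hy =>
    obtain ⟨n, a, b, hne, rfl, h⟩ := hx
    obtain ⟨m, a', b', hne', rfl, h'⟩ := hy
    refine ⟨n + m, Fin.append a a', Fin.append b b', fun i => ?_, ?_, fun i => ?_⟩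
    · refine Fin.addCases (fun i => ?_) (fun i => ?_) i
      · simpa using hne i
      · simpa using hne' i
    · simp [Fin.sum_univ_add]
    · refine Fin.addCases (fun i => ?_) (fun i => ?_) i
      · simpa using h i
      · simpa using h' i
  | smul c x _ hx =>
    rcases eq_or_ne c 0 with rfl | hc
    · simpa only [zero_smul] using zero
    obtain ⟨n, a, b, hne, rfl, h⟩ := hx
    refine ⟨n, fun i => c • a i, b, fun i => ⟨?_, (hne i).2⟩, ?_, fun i => ?_⟩
    · exact fun h0 => (hne i).1 (by simpa [hc] using congrArg (c⁻¹ • ·) h0)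
    · simp_rw [Finset.smul_sum, TensorProduct.smul_tmul']
    · rw [hv.map_smul hc]
      exact h i

/-- Contraction of the first tensor factor with a linear form. -/
noncomputable def contractFst (l : A →ₗ[k] k) : A ⊗[k] B →ₗ[k] B :=
  (TensorProduct.lid k B).toLinearMap ∘ₗ l.rTensor B

theorem contractFst_tmul (l : A →ₗ[k] k) (a : A) (b : B) :
    contractFst l (a ⊗ₜ[k] b) = l a • b := by
  simp [contractFst]

theorem scaleW_add_scaleW_contractFst_le (hw : LiftsTrivial k w)
    (hS : 0 ≤ S) (hT : 0 ≤ T) {l : A →ₗ[k] k} {α : WithBot ℝ} (hl : ∀ a, v a < α → l a = 0)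
    {x : A ⊗[k] B} (hx : x ∈ sumFiltration k S T v w t) :
    scaleW S α + scaleW T (w (contractFst l x)) ≤ t := by
  induction hx using Submodule.span_induction with
  | mem x hx =>
    obtain ⟨a, b, rfl, h⟩ := hx
    rw [contractFst_tmul]
    by_cases ha : l a = 0
    · simp [ha, hw.map_zero]
    · rw [hw.map_smul ha]
      exact (add_le_add_left (scaleW_mono hS (not_lt.mp (mt (hl a) ha))) _).trans h
  | zero => simp [hw.map_zero]
  | add x y _ _ hx hy =>
    rw [_root_.map_add]
    rcases le_max_iff.mp (hw.map_add_le (contractFst l x) (contractFst l y)) with h | h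
    · exact (add_le_add_right (scaleW_mono hT h) _).trans hx
    · exact (add_le_add_right (scaleW_mono hT h) _).trans hy
  | smul c x _ hx =>
    rw [_root_.map_smul]
    exact (add_le_add_right (scaleW_mono hT (hw.map_smul_le _ _)) _).trans hx

/-- The index `j` is of finite weight and maximises the lexicographic weight. -/
def IsLeadingIndex {ι X Y : Type*} (S T : ℝ) (v : X → WithBot ℝ) (w : Y → WithBot ℝ)
    (a : ι → X) (f : ι → Y) (j : ι) : Prop :=
  ∃ α β : ℝ, v (a j) = α ∧ w (f j) = β ∧ ∀ i (α' β' : ℝ), v (a i) = α' → w (f i) = β' →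
    lexWeight S T α' β' ≤ lexWeight S T α β

theorem exists_isLeadingIndex {ι X Y : Type*} [Finite ι] {v : X → WithBot ℝ} {w : Y → WithBot ℝ}
    {a : ι → X} {f : ι → Y}
    (h : ∃ i, v (a i) ≠ ⊥ ∧ w (f i) ≠ ⊥) : ∃ j, IsLeadingIndex S T v w a f j := by
  obtain ⟨j, ⟨hj, hj'⟩, hmax⟩ := Set.exists_max_image {i | v (a i) ≠ ⊥ ∧ w (f i) ≠ ⊥}
    (fun i => lexWeight S T ((v (a i)).unbotD 0) ((w (f i)).unbotD 0)) (Set.toFinite _) h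
  obtain ⟨α, hα⟩ := WithBot.ne_bot_iff_exists.mp hj
  obtain ⟨β, hβ⟩ := WithBot.ne_bot_iff_exists.mp hj'
  refine ⟨j, α, β, hα.symm, hβ.symm, fun i α' β' ha hb => ?_⟩
  simpa [← hα, ← hβ, ha, hb] using hmax i (by simp [ha, hb])

theorem IsLeadingIndex.sum_mem {ι : Type*} [Fintype ι] {a : ι → A} {f : ι → B} {j : ι}
    (hj : IsLeadingIndex S T v w a f j) :
    ∑ i, a i ⊗ₜ[k] f i ∈ sumFiltration k S T v w (scaleW S (v (a j)) + scaleW T (w (f j))) := by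
  obtain ⟨α, β, hα, hβ, hmax⟩ := hj
  refine Submodule.sum_mem _ fun i _ => tmul_mem_sumFiltration ?_
  rw [hα, hβ]
  cases ha : v (a i) with
  | bot => simp
  | coe α' =>
    cases hb : w (f i) with
    | bot => simp
    | coe β' =>
      have := lexWeight_le_iff.mp (hmax i α' β' ha hb)
      simp only [scaleW_coe, ← WithBot.coe_add, WithBot.coe_le_coe]
      rcases this with h | h
      · exact h.le
      · exact h.1.le

/-- Multiplicativity of leading terms for the sum filtration. -/
theorem IsLeadingIndex.add_le_of_mul_mem [IsAlgClosed k] (hv : LiftsTrivial k v) (hw : LiftsTrivial k w)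
    (hS : 0 ≤ S) (hT : 0 ≤ T) {ι κ : Type*} [Fintype ι] [Fintype κ]
    {a : ι → A} {f : ι → B} {a' : κ → A} {g : κ → B} {j : ι} {j' : κ}
    (hj : IsLeadingIndex S T v w a f j) (hj' : IsLeadingIndex S T v w a' g j')
    (hf : LiftsTrivial.IsOrthogonal k w f) (hg : LiftsTrivial.IsOrthogonal k w g)
    (hmem : (∑ i, a i ⊗ₜ[k] f i) * (∑ i, a' i ⊗ₜ[k] g i) ∈ sumFiltration k S T v w t) :
    (scaleW S (v (a j)) + scaleW T (w (f j))) + (scaleW S (v (a' j')) + scaleW T (w (g j'))) ≤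
      t := by
  classical
  obtain ⟨α, β, hα, hβ, hmax⟩ := hj
  obtain ⟨γ, δ, hγ, hδ, hmax'⟩ := hj'
  obtain ⟨l, p, q, hl, hp, hq, hlm⟩ := hv.exists_initialForm
    ((Set.finite_range a).union (Set.finite_range a')) (d := a j) (d' := a' j')
    (by simp [hα]) (by simp [hγ])
  let c (i : ι) : k := if v (a i) = α ∧ w (f i) = β then p (a i) else 0
  let c' (i : κ) : k := if v (a' i) = γ ∧ w (g i) = δ then q (a' i) else 0
  have hF : w (f j) ≤ w (∑ i, c i • f i) := hf c j (by simp [c, hα, hβ, hp])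
  have hG : w (g j') ≤ w (∑ i, c' i • g i) := hg c' j' (by simp [c', hγ, hδ, hq])
  set z := contractFst l ((∑ i, a i ⊗ₜ[k] f i) * (∑ i, a' i ⊗ₜ[k] g i)) with hz
  have hdiff : (∑ i, c i • f i) * (∑ i, c' i • g i) - z ∈ hw.ltSubmodule (β + δ) := by
    rw [hz, Finset.sum_mul_sum, Finset.sum_mul_sum]
    simp only [map_sum, Algebra.TensorProduct.tmul_mul_tmul, contractFst_tmul,
      ← Finset.sum_sub_distrib, smul_mul_smul_comm, ← sub_smul]
    refine Submodule.sum_mem _ fun i _ => Submodule.sum_mem _ fun i' _ => ?_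
    by_cases h0 : c i * c' i' - l (a i * a' i') = 0
    · rw [h0, zero_smul]
      exact zero_mem _
    refine Submodule.smul_mem _ _ ?_
    rw [hw.mem_ltSubmodule, hw.map_mul]
    cases hb : w (f i) with
    | bot => simp
    | coe βi =>
    cases hd : w (g i') with
    | bot => simp
    | coe δi =>
    by_contra hlt
    rw [← WithBot.coe_add, WithBot.coe_lt_coe] at hlt
    by_cases htop : (v (a i) = α ∧ w (f i) = β) ∧ v (a' i') = γ ∧ w (g i') = δ
    · refine h0 ?_
      simp only [c, c', if_pos htop.1, if_pos htop.2]
      rw [hlm _ (.inl ⟨i, rfl⟩) _ (.inr ⟨i', rfl⟩) (by rw [htop.1.1, hα])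
        (by rw [htop.2.1, hγ]), sub_self]
    have hc : c i * c' i' = 0 := by
      simp only [c, c']
      by_cases h1 : v (a i) = α ∧ w (f i) = β
      · rw [if_neg fun h2 => htop ⟨h1, h2⟩, mul_zero]
      · rw [if_neg h1, zero_mul]
    rw [hc, zero_sub, neg_eq_zero] at h0
    have hle := not_lt.mp (mt (hl _) h0)
    rw [hv.map_mul, hα, hγ] at hle
    cases ha : v (a i) with
    | bot => simp [ha, ← WithBot.coe_add] at hle
    | coe αi =>
    cases ha' : v (a' i') with
    | bot => simp [ha', ← WithBot.coe_add] at hle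
    | coe γi =>
    rw [ha, ha'] at hle
    rcases lt_or_eq_of_lexWeight_le hS hT (hmax i αi βi ha hb) (hmax' i' γi δi ha' hd)
      (by exact_mod_cast hle) with h | ⟨⟨rfl, rfl⟩, rfl, rfl⟩
    · exact hlt h
    · exact htop ⟨⟨ha, hb⟩, ha', hd⟩
  have hzw : w (f j) + w (g j') ≤ w z := by
    by_contra! hlt
    have h1 : w (f j) + w (g j') ≤ w ((∑ i, c i • f i) * (∑ i, c' i • g i)) := by
      rw [hw.map_mul]
      exact add_le_add hF hG
    have h2 := hw.map_add_le ((∑ i, c i • f i) * (∑ i, c' i • g i) - z) z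
    rw [sub_add_cancel] at h2
    rw [hw.mem_ltSubmodule, WithBot.coe_add, ← hβ, ← hδ] at hdiff
    exact (h1.trans h2).not_gt (max_lt hdiff hlt)
  have h := scaleW_add_scaleW_contractFst_le hw hS hT hl hmem
  refine le_trans ?_ h
  rw [add_add_add_comm, ← scaleW_add, ← scaleW_add]
  exact add_le_add_right (scaleW_mono hT hzw) _

end Tensor

section Quasivaluation

variable {k A B : Type*} [Field k] [CommRing A] [CommRing B] [Algebra k A] [Algebra k B]
  {v : A → WithBot ℝ} {w : B → WithBot ℝ} {S T : ℝ} {t : WithBot ℝ}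

theorem exists_mem_sumFiltration (x : A ⊗[k] B) : ∃ t, x ∈ sumFiltration k S T v w t := by
  obtain ⟨n, a, b, rfl⟩ := TensorProduct.exists_sum_tmul_eq x
  exact ⟨Finset.univ.sup fun i => scaleW S (v (a i)) + scaleW T (w (b i)),
    Submodule.sum_mem _ fun i hi => tmul_mem_sumFiltration
      (Finset.le_sup (f := fun i => scaleW S (v (a i)) + scaleW T (w (b i))) hi)⟩

/-- The values of the representations of `x` as a sum of nonzero pure tensors. -/
def representationValues (S T : ℝ) (v : A → WithBot ℝ) (w : B → WithBot ℝ) (x : A ⊗[k] B) :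
    Set (WithBot ℝ) :=
  {m : WithBot ℝ | ∃ (n : ℕ) (a : Fin n → A) (b : Fin n → B),
    (∀ i, a i ≠ 0 ∧ b i ≠ 0) ∧ x = ∑ i, a i ⊗ₜ[k] b i ∧
    m = Finset.univ.sup fun i => scaleW S (v (a i)) + scaleW T (w (b i))}

theorem exists_mem_representationValues_le (hv : LiftsTrivial k v) {x : A ⊗[k] B}
    (hx : x ∈ sumFiltration k S T v w t) : ∃ m ∈ representationValues S T v w x, m ≤ t := by
  obtain ⟨n, a, b, hne, hsum, h⟩ := exists_sum_tmul_of_mem_sumFiltration hv hx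
  exact ⟨_, ⟨n, a, b, hne, hsum, rfl⟩, Finset.sup_le fun i _ => h i⟩

theorem sInf_representationValues_le (hv : LiftsTrivial k v) {x : A ⊗[k] B}
    (hx : x ∈ sumFiltration k S T v w t) : sInf (representationValues S T v w x) ≤ t := by
  obtain ⟨m, hm, hmt⟩ := exists_mem_representationValues_le hv hx
  exact csInf_le_of_le (OrderBot.bddBelow _) hm hmt

theorem mem_sumFiltration_of_sInf_lt (hv : LiftsTrivial k v) {x : A ⊗[k] B}
    (hx : sInf (representationValues S T v w x) < t) : x ∈ sumFiltration k S T v w t := by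
  obtain ⟨s, hs⟩ := exists_mem_sumFiltration (S := S) (T := T) (v := v) (w := w) x
  obtain ⟨m, hm, -⟩ := exists_mem_representationValues_le hv hs
  obtain ⟨_, ⟨n, a, b, -, rfl, rfl⟩, hlt⟩ := exists_lt_of_csInf_lt ⟨m, hm⟩ hx
  exact Submodule.sum_mem _ fun i hi => tmul_mem_sumFiltration
    ((Finset.le_sup (f := fun i => scaleW S (v (a i)) + scaleW T (w (b i))) hi).trans hlt.le)

variable {u : A ⊗[k] B → WithBot ℝ}

theorem quasivaluation_add_le
    (hle : ∀ x t, x ∈ sumFiltration k S T v w t → u x ≤ t)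
    (hlt : ∀ x t, u x < t → x ∈ sumFiltration k S T v w t) (x y : A ⊗[k] B) :
    u (x + y) ≤ max (u x) (u y) :=
  le_of_forall_gt_imp_ge_of_dense fun t ht => hle _ t <|
    add_mem (hlt x t ((le_max_left _ _).trans_lt ht)) (hlt y t ((le_max_right _ _).trans_lt ht))

theorem exists_add_le_of_add_lt {a b c : WithBot ℝ} (h : a + b < c) :
    ∃ a' b', a < a' ∧ b < b' ∧ a' + b' ≤ c := by
  have hc : c ≠ ⊥ := ne_bot_of_gt h
  lift c to ℝ using hc
  have main {a b : ℝ} (h : a + b < c) : (a : WithBot ℝ) < ((a + (c - a - b) / 2 : ℝ) : WithBot ℝ) ∧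
      (b : WithBot ℝ) < ((b + (c - a - b) / 2 : ℝ) : WithBot ℝ) ∧
      ((a + (c - a - b) / 2 : ℝ) : WithBot ℝ) + ((b + (c - a - b) / 2 : ℝ) : WithBot ℝ) ≤ c := by
    simp only [← WithBot.coe_add, WithBot.coe_le_coe, WithBot.coe_lt_coe]
    refine ⟨?_, ?_, ?_⟩ <;> linarith
  induction a with
  | bot =>
    induction b with
    | bot => exact ⟨0, c, WithBot.bot_lt_coe 0, WithBot.bot_lt_coe c, (zero_add _).le⟩
    | coe b =>
      obtain ⟨-, h2, h3⟩ := main (a := c - b - 1) (b := b) (by linarith)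
      exact ⟨_, _, WithBot.bot_lt_coe _, h2, h3⟩
  | coe a =>
    induction b with
    | bot =>
      obtain ⟨h1, -, h3⟩ := main (a := a) (b := c - a - 1) (by linarith)
      exact ⟨_, _, h1, WithBot.bot_lt_coe _, h3⟩
    | coe b =>
      obtain ⟨h1, h2, h3⟩ := main (a := a) (b := b) (by exact_mod_cast h)
      exact ⟨_, _, h1, h2, h3⟩

theorem quasivaluation_mul_le (hv : LiftsTrivial k v) (hw : LiftsTrivial k w)
    (hle : ∀ x t, x ∈ sumFiltration k S T v w t → u x ≤ t)
    (hlt : ∀ x t, u x < t → x ∈ sumFiltration k S T v w t) (x y : A ⊗[k] B) :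
    u (x * y) ≤ u x + u y :=
  le_of_forall_gt_imp_ge_of_dense fun t ht => by
    obtain ⟨s, s', hs, hs', hst⟩ := exists_add_le_of_add_lt ht
    exact (hle _ _ (mul_mem_sumFiltration hv hw (hlt x s hs) (hlt y s' hs'))).trans hst

theorem exists_leading_of_ne_bot (hw : LiftsTrivial k w)
    (hle : ∀ x t, x ∈ sumFiltration k S T v w t → u x ≤ t) {x : A ⊗[k] B} (hx : u x ≠ ⊥) :
    ∃ (n : ℕ) (a : Fin n → A) (f : Fin n → B) (j : Fin n), LiftsTrivial.IsOrthogonal k w f ∧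
      x = ∑ i, a i ⊗ₜ[k] f i ∧ IsLeadingIndex S T v w a f j ∧
      u x ≤ scaleW S (v (a j)) + scaleW T (w (f j)) := by
  obtain ⟨n, a, f, hf, rfl⟩ := hw.exists_orthogonal_tmul x
  obtain ⟨j, hj⟩ : ∃ j, IsLeadingIndex S T v w a f j := by
    refine exists_isLeadingIndex ?_
    by_contra! h
    refine hx (le_bot_iff.mp (hle _ _ (Submodule.sum_mem _ fun i _ => tmul_mem_sumFiltration ?_)))
    by_cases ha : v (a i) = ⊥
    · simp [ha]
    · simp [h i ha]
  exact ⟨n, a, f, j, hf, rfl, hj, hle _ _ hj.sum_mem⟩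

theorem quasivaluation_mul [IsAlgClosed k] (hv : LiftsTrivial k v) (hw : LiftsTrivial k w)
    (hS : 0 ≤ S) (hT : 0 ≤ T)
    (hle : ∀ x t, x ∈ sumFiltration k S T v w t → u x ≤ t)
    (hlt : ∀ x t, u x < t → x ∈ sumFiltration k S T v w t) (x y : A ⊗[k] B) :
    u (x * y) = u x + u y := by
  refine (quasivaluation_mul_le hv hw hle hlt x y).antisymm ?_
  by_cases hx : u x = ⊥
  · simp [hx]
  by_cases hy : u y = ⊥
  · simp [hy]
  obtain ⟨n, a, f, j, hf, rfl, hj, hxj⟩ := exists_leading_of_ne_bot hw hle hx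
  obtain ⟨m, a', g, j', hg, rfl, hj', hyj⟩ := exists_leading_of_ne_bot hw hle hy
  refine (add_le_add hxj hyj).trans (le_of_forall_gt_imp_ge_of_dense fun t ht => ?_)
  exact hj.add_le_of_mul_mem hv hw hS hT hj' hf hg (hlt _ _ ht)

theorem quasivaluation_algebraMap [IsAlgClosed k] (hv : LiftsTrivial k v) (hw : LiftsTrivial k w)
    (hS : 0 ≤ S) (hT : 0 ≤ T)
    (hle : ∀ x t, x ∈ sumFiltration k S T v w t → u x ≤ t)
    (hlt : ∀ x t, u x < t → x ∈ sumFiltration k S T v w t) {c : k} (hc : c ≠ 0) :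
    u (algebraMap k (A ⊗[k] B) c) = 0 := by
  have hz : scaleW S (0 : WithBot ℝ) = 0 ∧ scaleW T (0 : WithBot ℝ) = 0 := by
    simp [← WithBot.coe_zero]
  have heq : algebraMap k (A ⊗[k] B) c = (1 : A) ⊗ₜ algebraMap k B c := by
    rw [Algebra.TensorProduct.algebraMap_apply, Algebra.algebraMap_eq_smul_one,
      Algebra.algebraMap_eq_smul_one, TensorProduct.smul_tmul]
  rw [heq]
  refine le_antisymm (hle _ _ (tmul_mem_sumFiltration ?_))
    (le_of_forall_gt_imp_ge_of_dense fun t ht => ?_)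
  · rw [hv.map_one, hw.map_algebraMap c hc, hz.1, hz.2, add_zero]
  · obtain ⟨l, p, q, hl, hp, hq, hlm⟩ := hv.exists_initialForm (Set.finite_singleton (1 : A))
      (d := 1) (d' := 1) (by simp [hv.map_one]) (by simp [hv.map_one])
    have hl1 : l 1 = 1 := by simpa [hp, hq] using hlm 1 rfl 1 rfl le_rfl le_rfl
    have h := scaleW_add_scaleW_contractFst_le hw hS hT hl (hlt _ _ ht)
    rwa [contractFst_tmul, hl1, one_smul, hw.map_algebraMap c hc, hv.map_one, add_zero, hz.1,
      hz.2, add_zero] at h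

end Quasivaluation

/-- Let A, B be commutative ℂ-algebra domains, v a valuation on A and w a valuation
on B lifting the trivial valuation on ℂ, and S, T ≥ 0.  Let u(0) = -∞ and, for
x ≠ 0, let u(x) be the infimum over all representations x = Σᵢ aᵢ ⊗ bᵢ (with aᵢ, bᵢ
nonzero) of maxᵢ (S·v(aᵢ) + T·w(bᵢ)).  Then u = S∘v ⊕ T∘w is a valuation on
A ⊗_ℂ B. -/
theorem sum_quasivaluation_is_valuation
    {A B : Type} [CommRing A] [CommRing B] [IsDomain A] [IsDomain B]
    [Algebra ℂ A] [Algebra ℂ B]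
    (v : A → WithBot ℝ) (w : B → WithBot ℝ)
    (hv1 : ∀ a b : A, v (a * b) = v a + v b)
    (hv2 : ∀ a b : A, v (a + b) ≤ max (v a) (v b))
    (hv3 : ∀ c : ℂ, c ≠ 0 → v (algebraMap ℂ A c) = 0)
    (hv4 : v 0 = ⊥)
    (hw1 : ∀ a b : B, w (a * b) = w a + w b)
    (hw2 : ∀ a b : B, w (a + b) ≤ max (w a) (w b))
    (hw3 : ∀ c : ℂ, c ≠ 0 → w (algebraMap ℂ B c) = 0)
    (hw4 : w 0 = ⊥)
    (S T : ℝ) (hS : 0 ≤ S) (hT : 0 ≤ T)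
    (u : A ⊗[ℂ] B → WithBot ℝ)
    (hu0 : u 0 = ⊥)
    (hu : ∀ x : A ⊗[ℂ] B, x ≠ 0 →
      u x = sInf {m : WithBot ℝ | ∃ (n : ℕ) (a : Fin n → A) (b : Fin n → B),
        (∀ i, a i ≠ 0 ∧ b i ≠ 0) ∧ x = ∑ i, a i ⊗ₜ[ℂ] b i ∧
        m = Finset.univ.sup fun i => scaleW S (v (a i)) + scaleW T (w (b i))}) :
    (∀ x y : A ⊗[ℂ] B, u (x * y) = u x + u y) ∧
    (∀ x y : A ⊗[ℂ] B, u (x + y) ≤ max (u x) (u y)) ∧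
    (∀ c : ℂ, c ≠ 0 → u (algebraMap ℂ (A ⊗[ℂ] B) c) = 0) := by
  have hv : LiftsTrivial ℂ v := ⟨hv1, hv2, hv3, hv4⟩
  have hw : LiftsTrivial ℂ w := ⟨hw1, hw2, hw3, hw4⟩
  have hle (x : A ⊗[ℂ] B) (t : WithBot ℝ) (hx : x ∈ sumFiltration ℂ S T v w t) : u x ≤ t := by
    rcases eq_or_ne x 0 with rfl | h0
    · simp [hu0]
    · rw [hu x h0]
      exact sInf_representationValues_le hv hx
  have hlt (x : A ⊗[ℂ] B) (t : WithBot ℝ) (hx : u x < t) : x ∈ sumFiltration ℂ S T v w t := by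
    rcases eq_or_ne x 0 with rfl | h0
    · exact zero_mem _
    · rw [hu x h0] at hx
      exact mem_sumFiltration_of_sInf_lt hv hx
  exact ⟨quasivaluation_mul hv hw hS hT hle hlt, quasivaluation_add_le hle hlt,
    fun c hc => quasivaluation_algebraMap hv hw hS hT hle hlt hc⟩
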